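/- Let τ be a critical Galton–Watson tree with offspring distribution p. Then, as n → ∞, τ conditioned on {W(τ) > n} converges locally in distribution to the immortal tree τ*: for every h ∈ ℕ and every tree t of height at most h, lim_{n→∞} P[r_h(τ) = t | W(τ) > n] = P[r_h(τ*) = t]. (Note that since p is critical and p_1 < 1, one has p_0 + p_1 < 1 and hence P[W(τ) > n] > 0 for every n.) -/

import Mathlib

open MeasureTheory Filter Set ProbabilityTheory
open scoped ENNReal Topology

namespace GWLocal

/-- Nodes of trees: finite sequences of positive integers. -/
abbrev Node : Type := List ℕ+

/-- A (rooted planar) tree, as a subset of the set `U` of finite sequences of positive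
integers: it contains the root `[]`, is closed under taking prefixes, and the children of
any node `u` form an initial segment `u1, …, uk` for some `k ∈ ℤ₊` (the out-degree of `u`). -/
def IsTree (t : Set Node) : Prop :=
  (([] : Node) ∈ t) ∧
  (∀ u ∈ t, ∀ v : Node, v <+: u → v ∈ t) ∧
  (∀ u ∈ t, ∃ k : ℕ, ∀ i : ℕ+, (u ++ [i]) ∈ t ↔ (i : ℕ) ≤ k)

/-- The out-degree `k_u(t)` of the node `u` in the tree `t`. -/
noncomputable def deg (t : Set Node) (u : Node) : ℕ := {i : ℕ+ | (u ++ [i]) ∈ t}.ncard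

/-- `restrict h t = r_h(t)`, the tree `t` restricted below height `h`. -/
def restrict (h : ℕ) (t : Set Node) : Set Node := {u ∈ t | u.length ≤ h}

/-- `Y h t = Y_h(t)`, the number of nodes of `t` at height `h`. -/
noncomputable def Y (h : ℕ) (t : Set Node) : ℕ := {u ∈ t | u.length = h}.ncard

/-- The height `H(t) = sup{|u| : u ∈ t}` of a tree. -/
noncomputable def height (t : Set Node) : ℕ∞ := ⨆ u ∈ t, (u.length : ℕ∞)

/-- The width `W(t) = sup_{h ∈ ℤ₊} Y_h(t)` of a tree. -/
noncomputable def width (t : Set Node) : ℕ∞ := ⨆ h : ℕ, (Y h t : ℕ∞)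

/-- The subtree of `t` above the node `u`, re-rooted at `u`. -/
def subtreeAt (t : Set Node) (u : Node) : Set Node := {v | u ++ v ∈ t}

/-- The mean `μ = Σ_k k p_k` of an offspring distribution `p`. -/
noncomputable def mean (p : PMF ℕ) : ℝ≥0∞ := ∑' k : ℕ, (k : ℝ≥0∞) * p k

/-- `∏_{u ∈ t, |u| < h} p_{k_u(t)}`: the probability that a GW tree with offspring
distribution `p`, restricted below height `h`, equals `t`. -/
noncomputable def cylProb (p : PMF ℕ) (h : ℕ) (t : Set Node) : ℝ≥0∞ :=
  ∏ᶠ u ∈ {u ∈ t | u.length < h}, p (deg t u)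

/-- `μ^{-b} Y_b(t) ∏_{u ∈ t, |u| < b} p_{k_u(t)}`: the probability that Kesten's immortal
tree `τ*` associated with `p`, restricted below height `b`, equals `t`. -/
noncomputable def kesten (p : PMF ℕ) (b : ℕ) (t : Set Node) : ℝ≥0∞ :=
  ((mean p)⁻¹) ^ b * (Y b t : ℝ≥0∞) * cylProb p b t

/-- The σ-algebra on the space of trees generated by the events `{t : r_h(t) = s}`
(the Borel σ-algebra of the local ultrametric on trees). -/
def treeσ : MeasurableSpace (Set Node) :=
  MeasurableSpace.generateFrom
    {S : Set (Set Node) | ∃ (h : ℕ) (s : Set Node), S = {t | restrict h t = s}}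

/-- `τ` is a Galton–Watson tree with offspring distribution `p` under `P`:
it takes values in trees, is measurable, and for every `h ∈ ℕ = {1,2,…}` and every tree `t`
of height at most `h`, `P[r_h(τ) = t] = ∏_{u ∈ t, |u| < h} p_{k_u(t)}`. -/
def IsGW {Ω : Type*} [MeasurableSpace Ω] (P : Measure Ω) (p : PMF ℕ)
    (τ : Ω → Set Node) : Prop :=
  (∀ ω, IsTree (τ ω)) ∧ (@Measurable Ω (Set Node) _ treeσ τ) ∧
  (∀ h : ℕ, 1 ≤ h → ∀ t : Set Node, IsTree t → height t ≤ (h : ℕ∞) →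
    P {ω | restrict h (τ ω) = t} = cylProb p h t)

theorem mem_restrict {h : ℕ} {t : Set Node} {u : Node} :
    u ∈ restrict h t ↔ u ∈ t ∧ u.length ≤ h := Iff.rfl

theorem restrict_restrict {h m : ℕ} (hm : h ≤ m) (t : Set Node) :
    restrict h (restrict m t) = restrict h t := by
  ext u
  simp only [mem_restrict]
  constructor
  · rintro ⟨⟨h1, -⟩, h2⟩
    exact ⟨h1, h2⟩
  · rintro ⟨h1, h2⟩
    exact ⟨⟨h1, h2.trans hm⟩, h2⟩

theorem height_le_iff {h : ℕ} {t : Set Node} :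
    height t ≤ (h : ℕ∞) ↔ ∀ u ∈ t, u.length ≤ h := by
  simp [height, iSup_le_iff]

theorem restrict_eq_self {h : ℕ} {t : Set Node} (ht : height t ≤ (h : ℕ∞)) :
    restrict h t = t := by
  ext u
  exact ⟨fun hu => hu.1, fun hu => ⟨hu, height_le_iff.1 ht u hu⟩⟩

theorem height_restrict_le (h : ℕ) (t : Set Node) : height (restrict h t) ≤ (h : ℕ∞) :=
  height_le_iff.2 fun _ hu => hu.2

theorem IsTree.restrict {t : Set Node} (ht : IsTree t) (h : ℕ) : IsTree (restrict h t) := by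
  refine ⟨⟨ht.1, by simp⟩, ?_, ?_⟩
  · rintro u ⟨hu, hl⟩ v hv
    exact ⟨ht.2.1 u hu v hv, hv.length_le.trans hl⟩
  · rintro u ⟨hu, hl⟩
    obtain ⟨k, hk⟩ := ht.2.2 u hu
    by_cases hlt : u.length < h
    · refine ⟨k, fun i => ?_⟩
      rw [mem_restrict, hk i]
      simp
      omega
    · refine ⟨0, fun i => ?_⟩
      have := i.pos
      simp only [mem_restrict, List.length_append, List.length_singleton]
      omega

theorem mem_subtreeAt {t : Set Node} {u v : Node} : v ∈ subtreeAt t u ↔ u ++ v ∈ t := Iff.rfl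

theorem IsTree.subtreeAt {t : Set Node} (ht : IsTree t) {u : Node} (hu : u ∈ t) :
    IsTree (subtreeAt t u) := by
  refine ⟨by simpa [mem_subtreeAt] using hu, ?_, ?_⟩
  · intro v hv w hw
    exact ht.2.1 _ hv _ ((List.prefix_append_right_inj u).2 hw)
  · intro v hv
    obtain ⟨k, hk⟩ := ht.2.2 _ hv
    exact ⟨k, fun i => by rw [← hk i, mem_subtreeAt, List.append_assoc]⟩

theorem finite_pnat_le (k : ℕ) : {i : ℕ+ | (i : ℕ) ≤ k}.Finite :=
  Set.Finite.of_finite_image ((Set.finite_Iic k).subset (by rintro _ ⟨i, hi, rfl⟩; exact hi))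
    PNat.coe_injective.injOn

theorem ncard_pnat_le (k : ℕ) : {i : ℕ+ | (i : ℕ) ≤ k}.ncard = k := by
  rw [← Set.ncard_image_of_injective _ PNat.coe_injective]
  have : (fun i : ℕ+ => (i : ℕ)) '' {i : ℕ+ | (i : ℕ) ≤ k} = (Finset.Icc 1 k : Finset ℕ) := by
    ext j
    simp only [Set.mem_image, Set.mem_ofPred_eq, Finset.coe_Icc, Set.mem_Icc]
    constructor
    · rintro ⟨i, hi, rfl⟩
      exact ⟨i.pos, hi⟩
    · rintro ⟨h1, h2⟩
      exact ⟨⟨j, h1⟩, h2, rfl⟩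
  rw [this, Set.ncard_coe_finset]
  simp

theorem deg_eq_of_forall {t : Set Node} {u : Node} {k : ℕ}
    (hk : ∀ i : ℕ+, (u ++ [i]) ∈ t ↔ (i : ℕ) ≤ k) : deg t u = k := by
  rw [deg, ← ncard_pnat_le k]
  congr 1
  ext i
  exact hk i

theorem IsTree.mem_iff_le_deg {t : Set Node} (ht : IsTree t) {u : Node} (hu : u ∈ t) (i : ℕ+) :
    (u ++ [i]) ∈ t ↔ (i : ℕ) ≤ deg t u := by
  obtain ⟨k, hk⟩ := ht.2.2 u hu
  rw [deg_eq_of_forall hk, hk i]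

theorem IsTree.finite_level {t : Set Node} (ht : IsTree t) (h : ℕ) :
    {u ∈ t | u.length = h}.Finite := by
  induction h with
  | zero =>
    refine (Set.finite_singleton ([] : Node)).subset ?_
    rintro u ⟨-, hu⟩
    simpa using hu
  | succ h ih =>
    refine (ih.biUnion fun u _ => (finite_pnat_le (deg t u)).image fun i => u ++ [i]).subset ?_
    rintro u ⟨hu, hl⟩
    have hne : u ≠ [] := by
      rintro rfl
      simp at hl
    have hmem : u.dropLast ∈ t := ht.2.1 u hu _ (List.dropLast_prefix u)
    rw [← List.dropLast_append_getLast hne] at hu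
    simp only [Set.mem_iUnion]
    exact ⟨u.dropLast, ⟨hmem, by simp [hl]⟩, u.getLast hne,
      (ht.mem_iff_le_deg hmem _).1 hu, List.dropLast_append_getLast hne⟩

theorem IsTree.finite_restrict {t : Set Node} (ht : IsTree t) (h : ℕ) :
    (GWLocal.restrict h t).Finite := by
  refine ((Set.finite_Iic h).biUnion fun j _ => ht.finite_level j).subset ?_
  rintro u ⟨hu, hl⟩
  simp only [Set.mem_iUnion]
  exact ⟨u.length, hl, hu, rfl⟩

open Classical in
/-- The restriction of a tree below height `h`, as a finite set (empty if the restriction is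
infinite, which does not happen for trees). -/
noncomputable def trunc (h : ℕ) (t : Set Node) : Finset Node :=
  if hf : (restrict h t).Finite then hf.toFinset else ∅

theorem IsTree.coe_trunc {t : Set Node} (ht : IsTree t) (h : ℕ) :
    (trunc h t : Set Node) = GWLocal.restrict h t := by
  simp [trunc, ht.finite_restrict h]

theorem IsTree.trunc_eq_iff {t : Set Node} (ht : IsTree t) (h : ℕ) (F : Finset Node) :
    trunc h t = F ↔ GWLocal.restrict h t = F := by
  rw [← ht.coe_trunc, Finset.coe_inj]

theorem IsTree.trunc_eq_trunc_iff {s t : Set Node} (hs : IsTree s) (ht : IsTree t) (h : ℕ) :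
    trunc h s = trunc h t ↔ GWLocal.restrict h s = GWLocal.restrict h t := by
  rw [hs.trunc_eq_iff, ht.coe_trunc]

/-- The nodes at height `h`, as a finite set. -/
noncomputable def level (h : ℕ) (t : Set Node) : Finset Node :=
  (trunc h t).filter fun u => u.length = h

theorem IsTree.mem_level {t : Set Node} (ht : IsTree t) {h : ℕ} {u : Node} :
    u ∈ level h t ↔ u ∈ t ∧ u.length = h := by
  rw [level, Finset.mem_filter, ← Finset.mem_coe, ht.coe_trunc, mem_restrict]
  constructor
  · rintro ⟨⟨h1, -⟩, h2⟩
    exact ⟨h1, h2⟩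
  · rintro ⟨h1, h2⟩
    exact ⟨⟨h1, h2.le⟩, h2⟩

theorem IsTree.coe_level {t : Set Node} (ht : IsTree t) (h : ℕ) :
    (level h t : Set Node) = {u ∈ t | u.length = h} := by
  ext u
  exact ht.mem_level

theorem IsTree.Y_eq_card {t : Set Node} (ht : IsTree t) (h : ℕ) : Y h t = (level h t).card := by
  rw [Y, ← ht.coe_level, Set.ncard_coe_finset]

theorem Y_restrict {h m : ℕ} (hm : h ≤ m) (t : Set Node) : Y h (restrict m t) = Y h t := by
  unfold Y
  congr 1
  ext u
  simp only [mem_restrict, Set.mem_ofPred_eq]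
  constructor
  · rintro ⟨⟨h1, -⟩, h2⟩
    exact ⟨h1, h2⟩
  · rintro ⟨h1, h2⟩
    exact ⟨⟨h1, h2.le.trans hm⟩, h2⟩

theorem deg_restrict {h : ℕ} {u : Node} (hu : u.length < h) (t : Set Node) :
    deg (restrict h t) u = deg t u := by
  unfold deg
  congr 1
  ext i
  simp only [mem_restrict, Set.mem_ofPred_eq, List.length_append, List.length_singleton]
  exact ⟨fun h => h.1, fun h => ⟨h, hu⟩⟩

theorem cylProb_restrict (p : PMF ℕ) {h m : ℕ} (hm : h ≤ m) (t : Set Node) :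
    cylProb p h (restrict m t) = cylProb p h t := by
  refine finprod_mem_congr ?_ ?_
  · ext u
    simp only [mem_restrict, Set.mem_ofPred_eq]
    constructor
    · rintro ⟨⟨h1, -⟩, h2⟩
      exact ⟨h1, h2⟩
    · rintro ⟨h1, h2⟩
      exact ⟨⟨h1, h2.le.trans hm⟩, h2⟩
  · rintro u ⟨-, hu⟩
    rw [deg_restrict (hu.trans_le hm)]

theorem IsTree.restrict_zero {t : Set Node} (ht : IsTree t) :
    GWLocal.restrict 0 t = {[]} := by
  ext u
  simp only [mem_restrict, Nat.le_zero, List.length_eq_zero_iff, Set.mem_singleton_iff]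
  exact ⟨fun h => h.2, fun h => ⟨h ▸ ht.1, h⟩⟩

theorem IsTree.Y_zero {t : Set Node} (ht : IsTree t) : Y 0 t = 1 := by
  rw [← Y_restrict le_rfl, ht.restrict_zero, Y]
  have : {u : Node | u ∈ ({[]} : Set Node) ∧ u.length = 0} = {[]} := by
    ext u
    simp
  rw [this, Set.ncard_singleton]

theorem cylProb_zero (p : PMF ℕ) (t : Set Node) : cylProb p 0 t = 1 := by
  simp [cylProb]

theorem IsTree.cylProb_one (p : PMF ℕ) {t : Set Node} (ht : IsTree t) :
    cylProb p 1 t = p (deg t []) := by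
  have : {u ∈ t | u.length < 1} = {[]} := by
    ext u
    simp only [Nat.lt_one_iff, List.length_eq_zero_iff, Set.mem_ofPred_eq, Set.mem_singleton_iff]
    exact ⟨fun h => h.2, fun h => ⟨h ▸ ht.1, h⟩⟩
  rw [cylProb, this, finprod_mem_singleton]

theorem Y_one (t : Set Node) : Y 1 t = deg t [] := by
  have hinj : Function.Injective (fun i : ℕ+ => ([i] : Node)) := fun i j h => by simpa using h
  rw [deg, ← Set.ncard_image_of_injective _ hinj, Y]
  congr 1
  ext u
  simp only [List.length_eq_one_iff, Set.mem_ofPred_eq, Set.mem_image, List.nil_append]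
  constructor
  · rintro ⟨h1, i, rfl⟩
    exact ⟨i, h1, rfl⟩
  · rintro ⟨i, h1, rfl⟩
    exact ⟨h1, i, rfl⟩

theorem deg_append (t : Set Node) (u v : Node) : deg t (u ++ v) = deg (subtreeAt t u) v := by
  simp only [deg, mem_subtreeAt, List.append_assoc]

theorem IsTree.take_mem {t : Set Node} (ht : IsTree t) {u : Node} (hu : u ∈ t) (h : ℕ) :
    u.take h ∈ t := ht.2.1 u hu _ (List.take_prefix h u)

theorem setOf_length_eq_add {t : Set Node} (ht : IsTree t) (h m : ℕ) :
    {u ∈ t | u.length = h + m} =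
      ⋃ u ∈ level h t, (u ++ ·) '' {v ∈ subtreeAt t u | v.length = m} := by
  ext w
  simp only [Set.mem_iUnion, Set.mem_image, Set.mem_ofPred_eq, ht.mem_level, mem_subtreeAt]
  constructor
  · rintro ⟨hw, hl⟩
    exact ⟨w.take h, ⟨ht.take_mem hw h, by simp; omega⟩, w.drop h, by simpa [hl] using hw,
      List.take_append_drop h w⟩
  · rintro ⟨u, ⟨hu, hul⟩, v, ⟨hv, hvl⟩, rfl⟩
    exact ⟨hv, by simp [hul, hvl]⟩

theorem pairwiseDisjoint_image_append {D : Set Node} {h : ℕ} (hD : ∀ u ∈ D, u.length = h)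
    (S : Node → Set Node) : D.PairwiseDisjoint fun u => (u ++ ·) '' S u := by
  intro u hu v hv huv
  rw [Function.onFun, Set.disjoint_left]
  rintro _ ⟨a, -, rfl⟩ ⟨b, -, hb⟩
  exact huv (List.append_inj_left hb.symm (by rw [hD u hu, hD v hv]))

theorem IsTree.Y_add {t : Set Node} (ht : IsTree t) (h m : ℕ) :
    Y (h + m) t = ∑ u ∈ level h t, Y m (GWLocal.subtreeAt t u) := by
  rw [Y, setOf_length_eq_add ht, ← finsum_mem_coe_finset]
  have hD : ∀ u ∈ (level h t : Set Node), u ∈ t ∧ u.length = h := fun u hu => ht.mem_level.1 hu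
  simp only [← Finset.mem_coe]
  rw [Set.Finite.ncard_biUnion (Finset.finite_toSet _)
    (fun u hu => ((ht.subtreeAt (hD u hu).1).finite_level m).image _)
    (pairwiseDisjoint_image_append (fun u hu => (hD u hu).2) _)]
  exact finsum_mem_congr rfl fun u _ =>
    Set.ncard_image_of_injective _ (List.append_right_injective u)

theorem IsTree.cylProb_add (p : PMF ℕ) {t : Set Node} (ht : IsTree t) (h m : ℕ) :
    cylProb p (h + m) t =
      cylProb p h t * ∏ u ∈ level h t, cylProb p m (GWLocal.subtreeAt t u) := by
  have hD : ∀ u ∈ (level h t : Set Node), u ∈ t ∧ u.length = h := fun u hu => ht.mem_level.1 hu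
  have hsplit : {u ∈ t | u.length < h + m} = {u ∈ t | u.length < h} ∪
      ⋃ u ∈ (level h t : Set Node),
        (u ++ ·) '' {v ∈ GWLocal.subtreeAt t u | v.length < m} := by
    ext w
    simp only [Set.mem_union, Set.mem_iUnion, Set.mem_image, Set.mem_ofPred_eq, Finset.mem_coe,
      ht.mem_level, mem_subtreeAt]
    constructor
    · rintro ⟨hw, hl⟩
      by_cases hlt : w.length < h
      · exact Or.inl ⟨hw, hlt⟩
      · exact Or.inr ⟨w.take h, ⟨ht.take_mem hw h, by simp; omega⟩, w.drop h,
          ⟨by simpa using hw, by simp; omega⟩, List.take_append_drop h w⟩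
    · rintro (⟨hw, hl⟩ | ⟨u, ⟨hu, hul⟩, v, ⟨hv, hvl⟩, rfl⟩)
      · exact ⟨hw, by omega⟩
      · exact ⟨hv, by simp; omega⟩
  have hfin : ∀ {s : Set Node} (_ : IsTree s) (j : ℕ), {u ∈ s | u.length < j}.Finite :=
    fun hs j => (hs.finite_restrict j).subset fun u hu => ⟨hu.1, hu.2.le⟩
  have hfin' : ∀ u ∈ (level h t : Set Node),
      ((u ++ ·) '' {v ∈ GWLocal.subtreeAt t u | v.length < m}).Finite :=
    fun u hu => (hfin (ht.subtreeAt (hD u hu).1) m).image _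
  rw [cylProb, hsplit, finprod_mem_union _ (hfin ht h)
    ((Finset.finite_toSet _).biUnion hfin'), finprod_mem_biUnion
      (pairwiseDisjoint_image_append (fun u hu => (hD u hu).2) _) (Finset.finite_toSet _) hfin',
      finprod_mem_coe_finset, cylProb]
  · congr 1
    refine Finset.prod_congr rfl fun u _ => ?_
    rw [finprod_mem_image (List.append_right_injective u).injOn, cylProb]
    simp only [deg_append]
  · rw [Set.disjoint_left]
    rintro w ⟨-, hw⟩ hw'
    simp only [Set.mem_iUnion, Set.mem_image] at hw'
    obtain ⟨u, hu, v, -, rfl⟩ := hw'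
    have := (hD u hu).2
    simp at hw
    omega

theorem level_congr {s t : Set Node} (hs : IsTree s) (ht : IsTree t) {h : ℕ}
    (hst : restrict h s = restrict h t) : level h s = level h t := by
  rw [level, level, (hs.trunc_eq_trunc_iff ht h).2 hst]

theorem restrict_add_eq_iff {s t : Set Node} (hs : IsTree s) (ht : IsTree t) (h m : ℕ) :
    restrict (h + m) s = restrict (h + m) t ↔ restrict h s = restrict h t ∧
      ∀ u ∈ level h t, restrict m (subtreeAt s u) = restrict m (subtreeAt t u) := by
  constructor
  · intro hst
    refine ⟨by rw [← restrict_restrict (Nat.le_add_right h m), hst,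
      restrict_restrict (Nat.le_add_right h m)], fun u hu => ?_⟩
    obtain ⟨-, hul⟩ := ht.mem_level.1 hu
    ext v
    have := Set.ext_iff.1 hst (u ++ v)
    simpa [mem_restrict, mem_subtreeAt, hul] using this
  · rintro ⟨h1, h2⟩
    have key : ∀ w : Node, w.length ≤ h + m → (w ∈ s ↔ w ∈ t) := by
      intro w hw
      by_cases hwh : w.length ≤ h
      · have := Set.ext_iff.1 h1 w
        simpa [mem_restrict, hwh] using this
      · have htake : w.take h ∈ s ↔ w.take h ∈ t := by
          have := Set.ext_iff.1 h1 (w.take h)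
          simpa [mem_restrict] using this
        by_cases hwt : w.take h ∈ t
        · have := Set.ext_iff.1 (h2 (w.take h) (ht.mem_level.2 ⟨hwt, by simp; omega⟩)) (w.drop h)
          simpa [mem_restrict, mem_subtreeAt, show w.length - h ≤ m by omega] using this
        · exact ⟨fun hw' => absurd (htake.1 (hs.take_mem hw' h)) hwt,
            fun hw' => absurd (ht.take_mem hw' h) hwt⟩
    ext w
    simp only [mem_restrict]
    exact ⟨fun hw => ⟨(key w hw.2).1 hw.1, hw.2⟩, fun hw => ⟨(key w hw.2).2 hw.1, hw.2⟩⟩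

/-- The tree obtained from `t`, of height at most `h`, by planting the tree `S u` on each
node `u` of height `h`. -/
def graft (h : ℕ) (t : Set Node) (S : Node → Set Node) : Set Node :=
  {w | w.take h ∈ t ∧ w.drop h ∈ S (w.take h)}

theorem mem_graft {h : ℕ} {t : Set Node} {S : Node → Set Node} {w : Node} :
    w ∈ graft h t S ↔ w.take h ∈ t ∧ w.drop h ∈ S (w.take h) := Iff.rfl

theorem mem_graft_of_length_le {h : ℕ} {t : Set Node} {S : Node → Set Node}
    (hS : ∀ u, IsTree (S u)) {w : Node} (hw : w.length ≤ h) : w ∈ graft h t S ↔ w ∈ t := by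
  rw [mem_graft, List.take_of_length_le hw, List.drop_eq_nil_of_le hw]
  exact and_iff_left (hS w).1

theorem IsTree.graft {h : ℕ} {t : Set Node} {S : Node → Set Node} (ht : IsTree t)
    (hS : ∀ u, IsTree (S u)) : IsTree (graft h t S) := by
  refine ⟨(mem_graft_of_length_le hS (by simp)).2 ht.1, ?_, ?_⟩
  · rintro w ⟨hw1, hw2⟩ v hv
    by_cases hvl : v.length ≤ h
    · rw [mem_graft_of_length_le hS hvl]
      exact ht.2.1 _ hw1 _ (List.prefix_take_iff.2 ⟨hv, hvl⟩)
    · obtain ⟨x, rfl⟩ := hv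
      rw [List.take_append_of_le_length (by omega)] at hw1 hw2
      rw [List.drop_append_of_le_length (by omega)] at hw2
      exact ⟨hw1, (hS _).2.1 _ hw2 _ (List.prefix_append _ _)⟩
  · rintro w ⟨hw1, hw2⟩
    by_cases hwl : w.length < h
    · rw [List.take_of_length_le hwl.le] at hw1
      obtain ⟨k, hk⟩ := ht.2.2 w hw1
      exact ⟨k, fun i => by rw [mem_graft_of_length_le hS (by simp; omega), hk]⟩
    · obtain ⟨k, hk⟩ := (hS _).2.2 _ hw2
      refine ⟨k, fun i => ?_⟩
      rw [mem_graft, List.take_append_of_le_length (by omega),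
        List.drop_append_of_le_length (by omega), hk i]
      exact and_iff_right hw1

theorem restrict_graft {h : ℕ} {t : Set Node} {S : Node → Set Node}
    (hS : ∀ u, IsTree (S u)) : restrict h (graft h t S) = restrict h t := by
  ext w
  simp only [mem_restrict]
  exact and_congr_left fun hw => mem_graft_of_length_le hS hw

theorem subtreeAt_graft {h : ℕ} {t : Set Node} {S : Node → Set Node} {u : Node} (hu : u ∈ t)
    (hul : u.length = h) : subtreeAt (graft h t S) u = S u := by
  ext v
  rw [mem_subtreeAt, mem_graft, List.take_append_of_le_length hul.ge,
    List.drop_append_of_le_length hul.ge, List.take_of_length_le hul.le,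
    List.drop_eq_nil_of_le hul.le]
  exact and_iff_right hu

/-- The infinite tree in which every node has out-degree `k`. -/
def regularTree (k : ℕ) : Set Node := {u | ∀ i ∈ u, (i : ℕ) ≤ k}

theorem isTree_regularTree (k : ℕ) : IsTree (regularTree k) := by
  refine ⟨by simp [regularTree], fun u hu v hv i hi => hu i (hv.subset hi), fun u hu => ⟨k, ?_⟩⟩
  intro i
  constructor
  · intro h
    exact h i (by simp)
  · intro h j hj
    rcases List.mem_append.1 hj with hj | hj
    · exact hu j hj
    · rw [List.mem_singleton.1 hj]
      exact h

theorem subtreeAt_regularTree {k : ℕ} {u : Node} (hu : u ∈ regularTree k) :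
    subtreeAt (regularTree k) u = regularTree k := by
  ext v
  refine ⟨fun h i hi => h i (List.mem_append_right u hi), fun h i hi => ?_⟩
  rcases List.mem_append.1 hi with hi | hi
  · exact hu i hi
  · exact h i hi

theorem deg_regularTree {k : ℕ} {u : Node} (hu : u ∈ regularTree k) :
    deg (regularTree k) u = k := by
  have hroot : deg (regularTree k) [] = k :=
    deg_eq_of_forall fun i => by simp [regularTree]
  have h := deg_append (regularTree k) u []
  rwa [List.append_nil, subtreeAt_regularTree hu, hroot] at h

theorem Y_regularTree (k h : ℕ) : Y h (regularTree k) = k ^ h := by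
  have hT := isTree_regularTree k
  induction h with
  | zero => rw [hT.Y_zero, pow_zero]
  | succ h ih =>
    rw [hT.Y_add, pow_succ, ← ih, hT.Y_eq_card, ← smul_eq_mul, ← Finset.sum_const]
    refine Finset.sum_congr rfl fun u hu => ?_
    rw [Y_one, subtreeAt_regularTree (hT.mem_level.1 hu).1, deg_regularTree hT.1]

theorem cylProb_regularTree_ne_zero {p : PMF ℕ} {k : ℕ} (hk : p k ≠ 0) (h : ℕ) :
    cylProb p h (regularTree k) ≠ 0 := by
  have hT := isTree_regularTree k
  induction h with
  | zero => simp [cylProb_zero]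
  | succ h ih =>
    rw [hT.cylProb_add]
    refine mul_ne_zero ih (Finset.prod_ne_zero_iff.2 fun u hu => ?_)
    rwa [subtreeAt_regularTree (hT.mem_level.1 hu).1, hT.cylProb_one, deg_regularTree hT.1]

theorem restrict_one_eq_iff {t : Set Node} (ht : IsTree t) (k : ℕ) :
    restrict 1 t = restrict 1 (regularTree k) ↔ Y 1 t = k := by
  have hT := isTree_regularTree k
  rw [Y_one]
  constructor
  · intro h
    rw [← deg_restrict (h := 1) (by simp) t, h, deg_restrict (by simp), deg_regularTree hT.1]
  · rintro rfl
    ext u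
    simp only [mem_restrict]
    refine and_congr_left fun hu => ?_
    match u, hu with
    | [], _ => exact iff_of_true ht.1 hT.1
    | [i], _ =>
      rw [← List.nil_append [i], ht.mem_iff_le_deg ht.1, hT.mem_iff_le_deg hT.1,
        deg_regularTree hT.1]

instance : MeasurableSpace (Finset Node) := ⊤

instance : DiscreteMeasurableSpace (Finset Node) := ⟨fun _ => MeasurableSpace.measurableSet_top⟩

theorem trunc_congr {h : ℕ} {s t : Set Node} (hst : restrict h s = restrict h t) :
    trunc h s = trunc h t := by
  unfold trunc
  split_ifs with hs ht ht
  · exact Finset.coe_injective (by simpa using hst)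
  · exact absurd (hst ▸ hs) ht
  · exact absurd (hst ▸ ht) hs
  · rfl

theorem trunc_subtreeAt_trunc {t : Set Node} (ht : IsTree t) (m : ℕ) (u : Node) :
    trunc m (subtreeAt (trunc (u.length + m) t : Set Node) u) = trunc m (subtreeAt t u) := by
  refine trunc_congr ?_
  ext v
  simp [ht.coe_trunc, mem_restrict, mem_subtreeAt]

theorem Y_trunc {t : Set Node} (ht : IsTree t) {h m : ℕ} (hm : h ≤ m) :
    Y h (trunc m t : Set Node) = Y h t := by
  rw [ht.coe_trunc, Y_restrict hm]

theorem width_le_iff {t : Set Node} {n : ℕ} : width t ≤ (n : ℕ∞) ↔ ∀ j, Y j t ≤ n := by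
  simp [width, iSup_le_iff]

section

variable {Ω : Type*} [MeasurableSpace Ω] {P : Measure Ω} {p : PMF ℕ} {τ : Ω → Set Node}

theorem IsGW.measurable_trunc (hGW : IsGW P p τ) (h : ℕ) :
    Measurable fun ω => trunc h (τ ω) := by
  refine measurable_to_countable' fun F => ?_
  have : (fun ω => trunc h (τ ω)) ⁻¹' {F} = τ ⁻¹' {t | restrict h t = F} := by
    ext ω
    exact (hGW.1 ω).trunc_eq_iff h F
  rw [this]
  exact hGW.2.1 (MeasurableSpace.measurableSet_generateFrom ⟨h, F, rfl⟩)

theorem IsGW.measurableSet_trunc_eq (hGW : IsGW P p τ) (h : ℕ) (F : Finset Node) :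
    MeasurableSet {ω | trunc h (τ ω) = F} :=
  hGW.measurable_trunc h (measurableSet_singleton F)

theorem IsGW.measurable_Y (hGW : IsGW P p τ) (h : ℕ) : Measurable fun ω => Y h (τ ω) := by
  have : (fun ω => Y h (τ ω)) =
      (fun F : Finset Node => Y h (F : Set Node)) ∘ fun ω => trunc h (τ ω) := by
    ext ω
    exact (Y_trunc (hGW.1 ω) le_rfl).symm
  rw [this]
  exact Measurable.of_discrete.comp (hGW.measurable_trunc h)

theorem IsGW.measurable_trunc_subtreeAt (hGW : IsGW P p τ) (m : ℕ) (u : Node) :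
    Measurable fun ω => trunc m (subtreeAt (τ ω) u) := by
  have : (fun ω => trunc m (subtreeAt (τ ω) u)) =
      (fun F : Finset Node => trunc m (subtreeAt (F : Set Node) u)) ∘
        fun ω => trunc (u.length + m) (τ ω) := by
    ext1 ω
    exact (trunc_subtreeAt_trunc (hGW.1 ω) m u).symm
  rw [this]
  exact Measurable.of_discrete.comp (hGW.measurable_trunc _)

theorem IsGW.measurableSet_lt_width (hGW : IsGW P p τ) (n : ℕ) :
    MeasurableSet {ω | (n : ℕ∞) < width (τ ω)} := by
  have : {ω | (n : ℕ∞) < width (τ ω)} = ⋃ j, {ω | n < Y j (τ ω)} := by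
    ext ω
    simp [width, lt_iSup_iff]
  rw [this]
  exact MeasurableSet.iUnion fun j => measurableSet_lt measurable_const (hGW.measurable_Y j)

variable [IsProbabilityMeasure P]

theorem IsGW.measure_trunc_eq (hGW : IsGW P p τ) (h : ℕ) {t : Set Node} (ht : IsTree t) :
    P {ω | trunc h (τ ω) = trunc h t} = cylProb p h t := by
  have hset : {ω | trunc h (τ ω) = trunc h t} = {ω | restrict h (τ ω) = restrict h t} := by
    ext ω
    exact (hGW.1 ω).trunc_eq_trunc_iff ht h
  rw [hset]
  rcases Nat.eq_zero_or_pos h with rfl | hh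
  · have : {ω | restrict 0 (τ ω) = restrict 0 t} = Set.univ := by
      ext ω
      simp [(hGW.1 ω).restrict_zero, ht.restrict_zero]
    rw [this, measure_univ, cylProb_zero]
  · rw [hGW.2.2 h hh _ (ht.restrict h) (height_restrict_le h t), cylProb_restrict p le_rfl]

/-- The branching property: on the event that `τ` coincides with `t` below height `h`, the
subtrees of `τ` above the nodes of height `h` are independent and distributed as `τ`. -/
theorem IsGW.map_subtrees (hGW : IsGW P p τ) (h m : ℕ) {t : Set Node} (ht : IsTree t) :
    (P.restrict {ω | trunc h (τ ω) = trunc h t}).map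
        (fun ω (u : level h t) => trunc m (subtreeAt (τ ω) u)) =
      cylProb p h t • Measure.pi fun _ : level h t => P.map fun ω => trunc m (τ ω) := by
  have hΦ : Measurable fun ω (u : level h t) => trunc m (subtreeAt (τ ω) u) :=
    measurable_pi_lambda _ fun u => hGW.measurable_trunc_subtreeAt m u
  have hprob : IsProbabilityMeasure (P.map fun ω => trunc m (τ ω)) :=
    Measure.isProbabilityMeasure_map (hGW.measurable_trunc m).aemeasurable
  have hlevel : ∀ ω, trunc h (τ ω) = trunc h t → level h (τ ω) = level h t := fun ω hω => by
    rw [level, level, hω]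
  refine Measure.ext_of_singleton fun S => ?_
  rw [Measure.map_apply hΦ (measurableSet_singleton S),
    Measure.restrict_apply (hΦ (measurableSet_singleton S)), Measure.smul_apply,
    Measure.pi_singleton, smul_eq_mul]
  simp only [Measure.map_apply (hGW.measurable_trunc m) (measurableSet_singleton _)]
  by_cases hS : ∀ u, ∃ s, IsTree s ∧ trunc m s = S u
  · choose s hs hsS using hS
    classical
    let S' : Node → Set Node := fun u =>
      if hu : u ∈ level h t then s ⟨u, hu⟩ else regularTree 0
    have hS' : ∀ u, IsTree (S' u) := by
      intro u
      by_cases hu : u ∈ level h t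
      · simp only [S', hu, dif_pos, hs]
      · simp only [S', hu, dif_neg, not_false_iff, isTree_regularTree]
    have hx := ht.graft (h := h) hS'
    have hlx : level h (graft h t S') = level h t := level_congr hx ht (restrict_graft hS')
    have hsub : ∀ u : level h t, subtreeAt (graft h t S') u = s u := by
      intro u
      obtain ⟨hu, hul⟩ := ht.mem_level.1 u.2
      rw [subtreeAt_graft hu hul]
      simp only [S', u.2, dif_pos]
    have hset : (fun ω (u : level h t) => trunc m (subtreeAt (τ ω) u)) ⁻¹' {S} ∩
        {ω | trunc h (τ ω) = trunc h t} =
        {ω | trunc (h + m) (τ ω) = trunc (h + m) (graft h t S')} := by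
      ext ω
      have hω := hGW.1 ω
      simp only [Set.mem_inter_iff, Set.mem_preimage, Set.mem_singleton_iff, Set.mem_ofPred_eq]
      rw [hω.trunc_eq_trunc_iff hx, restrict_add_eq_iff hω hx, restrict_graft hS', hlx,
        ← hω.trunc_eq_trunc_iff ht, and_comm, funext_iff]
      refine and_congr_right fun he => ?_
      rw [Subtype.forall]
      refine forall₂_congr fun u hu => ?_
      have huω : u ∈ τ ω := (hω.mem_level.1 (hlevel ω he ▸ hu)).1
      rw [hsub ⟨u, hu⟩, ← hsS, (hω.subtreeAt huω).trunc_eq_trunc_iff (hs _)]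
    rw [hset, hGW.measure_trunc_eq _ hx, hx.cylProb_add, hlx]
    congr 1
    · rw [← cylProb_restrict p le_rfl, restrict_graft hS', cylProb_restrict p le_rfl]
    · rw [← Finset.prod_coe_sort]
      refine Finset.prod_congr rfl fun u _ => ?_
      rw [hsub, ← hGW.measure_trunc_eq m (hs u), hsS]
      rfl
  · push Not at hS
    obtain ⟨u, hu⟩ := hS
    have h1 : (fun ω => trunc m (τ ω)) ⁻¹' {S u} = ∅ :=
      Set.eq_empty_of_forall_notMem fun ω hω => hu _ (hGW.1 ω) hω
    have h2 : (fun ω (u : level h t) => trunc m (subtreeAt (τ ω) u)) ⁻¹' {S} ∩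
        {ω | trunc h (τ ω) = trunc h t} = ∅ := by
      refine Set.eq_empty_of_forall_notMem fun ω ⟨hω1, hω2⟩ => ?_
      have huω : (u : Node) ∈ level h (τ ω) := (hlevel ω hω2).symm ▸ u.2
      exact hu _ ((hGW.1 ω).subtreeAt ((hGW.1 ω).mem_level.1 huω).1) (congrFun hω1 u)
    rw [h2, measure_empty, Finset.prod_eq_zero (Finset.mem_univ u) (by rw [h1, measure_empty]),
      mul_zero]

theorem IsGW.setLIntegral_Y_add (hGW : IsGW P p τ) (h m : ℕ) {t : Set Node} (ht : IsTree t) :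
    ∫⁻ ω in {ω | trunc h (τ ω) = trunc h t}, (Y (h + m) (τ ω) : ℝ≥0∞) ∂P =
      Y h t * cylProb p h t * ∫⁻ ω, (Y m (τ ω) : ℝ≥0∞) ∂P := by
  have hΦ : Measurable fun ω (u : level h t) => trunc m (subtreeAt (τ ω) u) :=
    measurable_pi_lambda _ fun u => hGW.measurable_trunc_subtreeAt m u
  have hprob : IsProbabilityMeasure (P.map fun ω => trunc m (τ ω)) :=
    Measure.isProbabilityMeasure_map (hGW.measurable_trunc m).aemeasurable
  have hY : ∀ ω ∈ {ω | trunc h (τ ω) = trunc h t}, (Y (h + m) (τ ω) : ℝ≥0∞) =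
      ∑ u : level h t, (Y m (trunc m (subtreeAt (τ ω) u) : Set Node) : ℝ≥0∞) := by
    intro ω hω
    have hlevel : level h (τ ω) = level h t := by rw [level, level, hω]
    rw [(hGW.1 ω).Y_add, ← Finset.sum_coe_sort, hlevel, Nat.cast_sum]
    refine Finset.sum_congr rfl fun u _ => ?_
    have huω : (u : Node) ∈ level h (τ ω) := hlevel.symm ▸ u.2
    rw [Y_trunc ((hGW.1 ω).subtreeAt ((hGW.1 ω).mem_level.1 huω).1) le_rfl]
  have hmean : ∫⁻ F, (Y m (F : Set Node) : ℝ≥0∞) ∂(P.map fun ω => trunc m (τ ω)) =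
      ∫⁻ ω, (Y m (τ ω) : ℝ≥0∞) ∂P := by
    rw [lintegral_map Measurable.of_discrete (hGW.measurable_trunc m)]
    simp only [Y_trunc (hGW.1 _) le_rfl]
  have hg : Measurable fun F : Finset Node => (Y m (F : Set Node) : ℝ≥0∞) :=
    Measurable.of_discrete
  have hterm : ∀ u : level h t, ∫⁻ ω in {ω | trunc h (τ ω) = trunc h t},
      (Y m (trunc m (subtreeAt (τ ω) u) : Set Node) : ℝ≥0∞) ∂P =
      cylProb p h t * ∫⁻ ω, (Y m (τ ω) : ℝ≥0∞) ∂P := by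
    intro u
    have hmap : ∫⁻ S, (Y m (S u : Set Node) : ℝ≥0∞)
        ∂(P.restrict {ω | trunc h (τ ω) = trunc h t}).map
          (fun ω (u : level h t) => trunc m (subtreeAt (τ ω) u)) =
        ∫⁻ ω in {ω | trunc h (τ ω) = trunc h t},
          (Y m (trunc m (subtreeAt (τ ω) u) : Set Node) : ℝ≥0∞) ∂P :=
      lintegral_map (f := fun S : level h t → Finset Node => (Y m (S u : Set Node) : ℝ≥0∞))
        (hg.comp (measurable_pi_apply u)) hΦ
    have heval : ∫⁻ S, (Y m (S u : Set Node) : ℝ≥0∞)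
        ∂Measure.pi (fun _ : level h t => P.map fun ω => trunc m (τ ω)) =
        ∫⁻ F, (Y m (F : Set Node) : ℝ≥0∞) ∂(P.map fun ω => trunc m (τ ω)) :=
      (measurePreserving_eval (fun _ : level h t => P.map fun ω => trunc m (τ ω))
        u).lintegral_comp hg
    rw [← hmap, hGW.map_subtrees h m ht, lintegral_smul_measure, heval, hmean, smul_eq_mul]
  rw [setLIntegral_congr_fun (hGW.measurableSet_trunc_eq h _) hY, lintegral_finsetSum]
  · rw [Finset.sum_congr rfl fun u _ => hterm u, Finset.sum_const, Finset.card_univ,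
      Fintype.card_coe, nsmul_eq_mul, ht.Y_eq_card, mul_assoc]
  · intro u _
    exact hg.comp (hGW.measurable_trunc_subtreeAt m u)

theorem IsGW.lintegral_Y_one (hGW : IsGW P p τ) :
    ∫⁻ ω, (Y 1 (τ ω) : ℝ≥0∞) ∂P = mean p := by
  rw [← lintegral_map (f := fun k : ℕ => (k : ℝ≥0∞)) Measurable.of_discrete (hGW.measurable_Y 1),
    lintegral_countable', mean]
  refine tsum_congr fun k => ?_
  have hT := isTree_regularTree k
  rw [Measure.map_apply (hGW.measurable_Y 1) (measurableSet_singleton k)]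
  congr 1
  have : (fun ω => Y 1 (τ ω)) ⁻¹' {k} = {ω | trunc 1 (τ ω) = trunc 1 (regularTree k)} := by
    ext ω
    exact ((hGW.1 ω).trunc_eq_trunc_iff hT 1).trans (restrict_one_eq_iff (hGW.1 ω) k) |>.symm
  rw [this, hGW.measure_trunc_eq 1 hT, hT.cylProb_one, deg_regularTree hT.1]

theorem IsGW.setLIntegral_Y (hGW : IsGW P p τ) (h : ℕ) {t : Set Node} (ht : IsTree t) :
    ∫⁻ ω in {ω | trunc h (τ ω) = trunc h t}, (Y h (τ ω) : ℝ≥0∞) ∂P =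
      Y h t * cylProb p h t := by
  have hY : ∀ ω, (Y 0 (τ ω) : ℝ≥0∞) = 1 := fun ω => by rw [(hGW.1 ω).Y_zero, Nat.cast_one]
  have := hGW.setLIntegral_Y_add h 0 ht
  simpa [hY] using this

/-- The generation sizes of a critical tree form a martingale. -/
theorem IsGW.setLIntegral_Y_succ (hGW : IsGW P p τ) (hcrit : mean p = 1) (h : ℕ)
    (A : Set (Finset Node)) :
    ∫⁻ ω in {ω | trunc h (τ ω) ∈ A}, (Y (h + 1) (τ ω) : ℝ≥0∞) ∂P =
      ∫⁻ ω in {ω | trunc h (τ ω) ∈ A}, (Y h (τ ω) : ℝ≥0∞) ∂P := by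
  have hX := hGW.measurable_trunc h
  have heq : (P.withDensity fun ω => (Y (h + 1) (τ ω) : ℝ≥0∞)).map (fun ω => trunc h (τ ω)) =
      (P.withDensity fun ω => (Y h (τ ω) : ℝ≥0∞)).map (fun ω => trunc h (τ ω)) := by
    refine Measure.ext_of_singleton fun F => ?_
    have hF : MeasurableSet ((fun ω => trunc h (τ ω)) ⁻¹' {F}) := hX (measurableSet_singleton F)
    rw [Measure.map_apply hX (measurableSet_singleton F),
      Measure.map_apply hX (measurableSet_singleton F), withDensity_apply _ hF,
      withDensity_apply _ hF]
    by_cases hne : ∃ ω, trunc h (τ ω) = F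
    · obtain ⟨ω, rfl⟩ := hne
      refine (hGW.setLIntegral_Y_add h 1 (hGW.1 ω)).trans ?_
      rw [hGW.lintegral_Y_one, hcrit, mul_one]
      exact (hGW.setLIntegral_Y h (hGW.1 ω)).symm
    · have : (fun ω => trunc h (τ ω)) ⁻¹' {F} = ∅ :=
        Set.eq_empty_of_forall_notMem fun ω hω => hne ⟨ω, hω⟩
      simp [this]
  have hA : MeasurableSet ((fun ω => trunc h (τ ω)) ⁻¹' A) := hX .of_discrete
  have := congrArg (fun ν : Measure (Finset Node) => ν A) heq
  simp only [Measure.map_apply hX (MeasurableSet.of_discrete (s := A)),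
    withDensity_apply _ hA] at this
  exact this

theorem IsGW.lintegral_Y (hGW : IsGW P p τ) (hcrit : mean p = 1) (h : ℕ) :
    ∫⁻ ω, (Y h (τ ω) : ℝ≥0∞) ∂P = 1 := by
  induction h with
  | zero => simp [(hGW.1 _).Y_zero]
  | succ h ih => simpa [ih] using hGW.setLIntegral_Y_succ hcrit h Set.univ

/-- Doob's maximal inequality for the generation sizes of a critical tree. -/
theorem IsGW.mul_measure_exists_lt_Y_le (hGW : IsGW P p τ) (hcrit : mean p = 1) (n m : ℕ) :
    (n : ℝ≥0∞) * P {ω | ∃ j ≤ m, n < Y j (τ ω)} ≤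
      ∫⁻ ω in {ω | ∃ j ≤ m, n < Y j (τ ω)}, (Y m (τ ω) : ℝ≥0∞) ∂P := by
  have hmeasY : ∀ j, MeasurableSet {ω | n < Y j (τ ω)} := fun j =>
    measurableSet_lt measurable_const (hGW.measurable_Y j)
  have hmarkov : ∀ (B : Set Ω) (j : ℕ), MeasurableSet B → (∀ ω ∈ B, n < Y j (τ ω)) →
      (n : ℝ≥0∞) * P B ≤ ∫⁻ ω in B, (Y j (τ ω) : ℝ≥0∞) ∂P := by
    intro B j hB h
    rw [← setLIntegral_const]
    exact setLIntegral_mono' hB fun ω hω => Nat.cast_le.2 (h ω hω).le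
  induction m with
  | zero =>
    have : {ω | ∃ j ≤ 0, n < Y j (τ ω)} = {ω | n < Y 0 (τ ω)} := by simp
    rw [this]
    exact hmarkov _ 0 (hmeasY 0) fun ω hω => hω
  | succ m ih =>
    have hB : {ω | ∃ j ≤ m, n < Y j (τ ω)} =
        {ω | trunc m (τ ω) ∈ {F : Finset Node | ∃ j ≤ m, n < Y j (F : Set Node)}} := by
      ext ω
      simp only [Set.mem_ofPred_eq]
      refine exists_congr fun j => and_congr_right fun hj => ?_
      rw [Y_trunc (hGW.1 ω) hj]
    have hBm : MeasurableSet {ω | ∃ j ≤ m, n < Y j (τ ω)} := by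
      rw [hB]
      exact hGW.measurable_trunc m .of_discrete
    have hsplit : {ω | ∃ j ≤ m + 1, n < Y j (τ ω)} = {ω | ∃ j ≤ m, n < Y j (τ ω)} ∪
        ({ω | n < Y (m + 1) (τ ω)} \ {ω | ∃ j ≤ m, n < Y j (τ ω)}) := by
      rw [Set.union_sdiff_self]
      ext ω
      simp only [Nat.le_succ_iff, or_and_right, exists_or, exists_eq_left, Set.mem_ofPred_eq,
        Set.mem_union]
    have hC := (hmeasY (m + 1)).diff hBm
    rw [hsplit, measure_union Set.disjoint_sdiff_right hC, mul_add,
      lintegral_union hC Set.disjoint_sdiff_right]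
    refine add_le_add ?_ (hmarkov _ _ hC fun ω hω => hω.1)
    refine ih.trans_eq ?_
    rw [hB, hGW.setLIntegral_Y_succ hcrit]

theorem IsGW.measure_lt_width_le (hGW : IsGW P p τ) (hcrit : mean p = 1) (n : ℕ) :
    P {ω | (n : ℕ∞) < width (τ ω)} ≤ (n : ℝ≥0∞)⁻¹ := by
  have hunion : {ω | (n : ℕ∞) < width (τ ω)} = ⋃ m, {ω | ∃ j ≤ m, n < Y j (τ ω)} := by
    ext ω
    simp only [width, lt_iSup_iff, Nat.cast_lt, Set.mem_ofPred_eq, Set.mem_iUnion]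
    exact ⟨fun ⟨j, hj⟩ => ⟨j, j, le_rfl, hj⟩, fun ⟨_, j, _, hj⟩ => ⟨j, hj⟩⟩
  have hmono : Monotone fun m => {ω | ∃ j ≤ m, n < Y j (τ ω)} :=
    fun a b hab ω ⟨j, hj, h⟩ => ⟨j, hj.trans hab, h⟩
  rw [ENNReal.le_inv_iff_mul_le, mul_comm, hunion, hmono.measure_iUnion, ENNReal.mul_iSup]
  refine iSup_le fun m => (hGW.mul_measure_exists_lt_Y_le hcrit n m).trans ?_
  exact (setLIntegral_le_lintegral _ _).trans_eq (hGW.lintegral_Y hcrit m)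

theorem exists_one_lt_apply_ne_zero (hp1 : p 1 < 1) (hcrit : mean p = 1) :
    ∃ k, 1 < k ∧ p k ≠ 0 := by
  by_contra! h
  have : mean p = p 1 := by
    rw [mean, tsum_eq_single 1, Nat.cast_one, one_mul]
    intro k hk
    rcases Nat.lt_or_gt_of_ne hk with hk | hk
    · simp [Nat.lt_one_iff.1 hk]
    · rw [h k hk, mul_zero]
  exact hp1.ne (this.symm.trans hcrit)

theorem IsGW.measure_lt_width_ne_zero (hGW : IsGW P p τ) (hp1 : p 1 < 1) (hcrit : mean p = 1)
    (n : ℕ) : P {ω | (n : ℕ∞) < width (τ ω)} ≠ 0 := by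
  obtain ⟨k, hk, hpk⟩ := exists_one_lt_apply_ne_zero hp1 hcrit
  have hT := isTree_regularTree k
  refine ne_bot_of_le_ne_bot (cylProb_regularTree_ne_zero hpk n) ?_
  rw [← hGW.measure_trunc_eq n hT]
  refine measure_mono fun ω hω => ?_
  have hY : Y n (τ ω) = k ^ n := by
    rw [← Y_regularTree, ← Y_trunc (hGW.1 ω) le_rfl, ← Y_trunc hT le_rfl, hω]
  refine lt_of_lt_of_le ?_ (le_iSup (fun j => (Y j (τ ω) : ℕ∞)) n)
  rw [hY]
  exact Nat.cast_lt.2 (Nat.lt_pow_self hk)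

theorem IsTree.Y_subtreeAt_le {t : Set Node} (ht : IsTree t) {u : Node} (hu : u ∈ t) (j : ℕ) :
    Y j (GWLocal.subtreeAt t u) ≤ Y (u.length + j) t := by
  rw [ht.Y_add]
  exact Finset.single_le_sum (f := fun v => Y j (GWLocal.subtreeAt t v))
    (fun _ _ => Nat.zero_le _) (ht.mem_level.2 ⟨hu, rfl⟩)

theorem IsGW.measure_trunc_eq_inter_width_le (hGW : IsGW P p τ) (h n : ℕ) {t : Set Node}
    (ht : IsTree t) :
    P ({ω | trunc h (τ ω) = trunc h t} ∩ {ω | width (τ ω) ≤ (n : ℕ∞)}) ≤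
      cylProb p h t * P {ω | width (τ ω) ≤ (n : ℕ∞)} ^ Y h t := by
  have hc : cylProb p h t ≠ ∞ := by
    rw [← hGW.measure_trunc_eq h ht]
    exact measure_ne_top _ _
  have hset : ∀ m, {ω | ∀ j ≤ m, Y j (τ ω) ≤ n} = (fun ω => trunc m (τ ω)) ⁻¹'
      {F : Finset Node | ∀ j ≤ m, Y j (F : Set Node) ≤ n} := by
    intro m
    ext ω
    refine forall₂_congr fun j hj => ?_
    rw [Y_trunc (hGW.1 ω) hj]
  have hle : ∀ m, P ({ω | trunc h (τ ω) = trunc h t} ∩ {ω | width (τ ω) ≤ (n : ℕ∞)}) ≤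
      cylProb p h t * P {ω | ∀ j ≤ m, Y j (τ ω) ≤ n} ^ Y h t := by
    intro m
    have hΦ : Measurable fun ω (u : level h t) => trunc m (subtreeAt (τ ω) u) :=
      measurable_pi_lambda _ fun u => hGW.measurable_trunc_subtreeAt m u
    have hprob : IsProbabilityMeasure (P.map fun ω => trunc m (τ ω)) :=
      Measure.isProbabilityMeasure_map (hGW.measurable_trunc m).aemeasurable
    have hA : MeasurableSet (Set.univ.pi fun _ : level h t =>
      {F : Finset Node | ∀ j ≤ m, Y j (F : Set Node) ≤ n}) := .of_discrete
    have hmap := congrArg (fun ν => ν (Set.univ.pi fun _ : level h t =>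
      {F : Finset Node | ∀ j ≤ m, Y j (F : Set Node) ≤ n})) (hGW.map_subtrees h m ht)
    simp only [Measure.map_apply hΦ hA, Measure.restrict_apply (hΦ hA), Measure.smul_apply,
      Measure.pi_pi, Measure.map_apply (hGW.measurable_trunc m) .of_discrete, ← hset m,
      Finset.prod_const, Finset.card_univ, Fintype.card_coe, ← ht.Y_eq_card,
      smul_eq_mul] at hmap
    rw [← hmap]
    refine measure_mono fun ω ⟨hω, hW⟩ => ⟨?_, hω⟩
    intro u _ j hj
    have hlevel : level h (τ ω) = level h t := by rw [level, level, hω]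
    have huω : (u : Node) ∈ level h (τ ω) := hlevel.symm ▸ u.2
    have hu := ((hGW.1 ω).mem_level.1 huω).1
    rw [Y_trunc ((hGW.1 ω).subtreeAt hu) hj]
    exact ((hGW.1 ω).Y_subtreeAt_le hu j).trans (width_le_iff.1 hW _)
  have hinter : {ω | width (τ ω) ≤ (n : ℕ∞)} = ⋂ m, {ω | ∀ j ≤ m, Y j (τ ω) ≤ n} := by
    ext ω
    simp only [width_le_iff, Set.mem_ofPred_eq, Set.mem_iInter]
    exact ⟨fun hω _ j _ => hω j, fun hω j => hω j j le_rfl⟩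
  have hlim : Tendsto (fun m => P {ω | ∀ j ≤ m, Y j (τ ω) ≤ n}) atTop
      (𝓝 (P {ω | width (τ ω) ≤ (n : ℕ∞)})) := by
    rw [hinter]
    refine tendsto_measure_iInter_atTop (fun m => ?_)
      (fun a b hab ω hω j hj => hω j (hj.trans hab)) ⟨0, measure_ne_top _ _⟩
    rw [hset m]
    exact (hGW.measurable_trunc m .of_discrete).nullMeasurableSet
  exact ge_of_tendsto' (ENNReal.Tendsto.const_mul
    (((ENNReal.continuous_pow _).tendsto _).comp hlim) (Or.inr hc)) hle

theorem pow_add_mul_geom_sum {v w : ℝ≥0∞} (hvw : w + v = 1) (k : ℕ) :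
    w ^ k + v * ∑ i ∈ Finset.range k, w ^ i = 1 := by
  induction k with
  | zero => simp
  | succ k ih =>
    calc w ^ (k + 1) + v * ∑ i ∈ Finset.range (k + 1), w ^ i
        = w ^ k * (w + v) + v * ∑ i ∈ Finset.range k, w ^ i := by
          rw [Finset.sum_range_succ]
          ring
      _ = 1 := by rw [hvw, mul_one, ih]

theorem IsGW.measure_width_le_add (hGW : IsGW P p τ) (n : ℕ) :
    P {ω | width (τ ω) ≤ (n : ℕ∞)} + P {ω | (n : ℕ∞) < width (τ ω)} = 1 := by
  rw [← measure_univ (μ := P), ← measure_add_measure_compl (hGW.measurableSet_lt_width n),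
    add_comm]
  congr 2
  ext ω
  simp

theorem IsGW.le_measure_trunc_eq_inter (hGW : IsGW P p τ) (h n : ℕ) {t : Set Node}
    (ht : IsTree t) :
    cylProb p h t * (P {ω | (n : ℕ∞) < width (τ ω)} *
        ∑ i ∈ Finset.range (Y h t), P {ω | width (τ ω) ≤ (n : ℕ∞)} ^ i) ≤
      P ({ω | trunc h (τ ω) = trunc h t} ∩ {ω | (n : ℕ∞) < width (τ ω)}) := by
  have hc : cylProb p h t ≠ ∞ := by
    rw [← hGW.measure_trunc_eq h ht]
    exact measure_ne_top _ _
  have hsum := pow_add_mul_geom_sum (hGW.measure_width_le_add n) (Y h t)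
  have hdecomp := measure_inter_add_sdiff {ω | trunc h (τ ω) = trunc h t} (μ := P)
    (hGW.measurableSet_lt_width n)
  have hdiff : {ω | trunc h (τ ω) = trunc h t} \ {ω | (n : ℕ∞) < width (τ ω)} =
      {ω | trunc h (τ ω) = trunc h t} ∩ {ω | width (τ ω) ≤ (n : ℕ∞)} := by
    ext ω
    simp
  rw [hdiff, hGW.measure_trunc_eq h ht] at hdecomp
  have hfin : cylProb p h t * P {ω | width (τ ω) ≤ (n : ℕ∞)} ^ Y h t ≠ ∞ :=
    ENNReal.mul_ne_top hc (ENNReal.pow_ne_top (measure_ne_top _ _))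
  refine (ENNReal.add_le_add_iff_right hfin).1 ?_
  calc _ = cylProb p h t := by rw [← mul_add, add_comm, hsum, mul_one]
    _ = _ := hdecomp.symm
    _ ≤ _ := add_le_add le_rfl (hGW.measure_trunc_eq_inter_width_le h n ht)

end

/-- A form of Scheffé's lemma: asymptotic lower bounds with total mass at least one, for
sub-probability weights, are limits. -/
theorem tendsto_of_tsum_le_one {ι : Type*} {a b : ℕ → ι → ℝ≥0∞} {κ : ι → ℝ≥0∞}
    (hba : ∀ n s, b n s ≤ a n s) (ha : ∀ n, ∑' s, a n s ≤ 1)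
    (hb : ∀ s, Tendsto (fun n => b n s) atTop (𝓝 (κ s))) (hκ : 1 ≤ ∑' s, κ s) (t : ι) :
    Tendsto (fun n => a n t) atTop (𝓝 (κ t)) := by
  classical
  refine tendsto_order.2 ⟨fun x hx => ?_, fun x hx => ?_⟩
  · filter_upwards [(tendsto_order.1 (hb t)).1 x hx] with n hn
    exact hn.trans_le (hba n t)
  · have hlt : 1 < ∑' s, if s = t then x else κ s := by
      rw [ENNReal.tsum_eq_add_tsum_ite t] at hκ ⊢
      simp only [if_true]
      have hcongr : ∀ s, (if s = t then 0 else if s = t then x else κ s) =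
          if s = t then 0 else κ s := fun s => by split_ifs <;> rfl
      simp only [hcongr]
      by_cases htop : (∑' s, if s = t then 0 else κ s) = ∞
      · simp [htop]
      · exact hκ.trans_lt (ENNReal.add_lt_add_right htop hx)
    rw [ENNReal.tsum_eq_iSup_sum, lt_iSup_iff] at hlt
    obtain ⟨F, hF⟩ := hlt
    have hlim : Tendsto (fun n => ∑ s ∈ F, if s = t then x else b n s) atTop
        (𝓝 (∑ s ∈ F, if s = t then x else κ s)) := by
      refine tendsto_finsetSum _ fun s _ => ?_
      split_ifs
      · exact tendsto_const_nhds
      · exact hb s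
    filter_upwards [(tendsto_order.1 hlim).1 1 hF] with n hn
    by_contra! hxa
    refine hn.not_ge (le_trans (Finset.sum_le_sum fun s _ => ?_)
      ((ENNReal.sum_le_tsum F).trans (ha n)))
    split_ifs with hs
    · rwa [hs]
    · exact hba n s

/-- **Corollary (local convergence of critical GW trees conditioned on large width).**
Let `τ` be a critical GW tree with offspring distribution `p`. Then `τ` conditioned on
`{W(τ) > n}` converges locally in distribution, as `n → ∞`, to Kesten's immortal tree `τ*`. -/
theorem gw_width_tail_local_convergence
    {Ω : Type*} [MeasurableSpace Ω] (P : Measure Ω) [IsProbabilityMeasure P]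
    (p : PMF ℕ) (hp1 : p 1 < 1) (hcrit : mean p = 1)
    (τ : Ω → Set Node) (hGW : IsGW P p τ) :
    ∀ h : ℕ, 1 ≤ h → ∀ t : Set Node, IsTree t → height t ≤ (h : ℕ∞) →
      Tendsto
        (fun n : ℕ =>
          P ({ω | restrict h (τ ω) = t} ∩ {ω | (n : ℕ∞) < width (τ ω)}) /
            P {ω | (n : ℕ∞) < width (τ ω)})
        atTop (𝓝 (kesten p h t)) := by
  intro h _ t ht hth
  have hX := hGW.measurable_trunc h
  have hprob : IsProbabilityMeasure (P.map fun ω => trunc h (τ ω)) :=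
    Measure.isProbabilityMeasure_map hX.aemeasurable
  have hE : ∀ F : Finset Node, P {ω | trunc h (τ ω) = F} =
      P.map (fun ω => trunc h (τ ω)) {F} := fun F =>
    (Measure.map_apply hX (measurableSet_singleton F)).symm
  let v : ℕ → ℝ≥0∞ := fun n => P {ω | (n : ℕ∞) < width (τ ω)}
  let w : ℕ → ℝ≥0∞ := fun n => P {ω | width (τ ω) ≤ (n : ℕ∞)}
  have hv0 : ∀ n, v n ≠ 0 := hGW.measure_lt_width_ne_zero hp1 hcrit
  have hvtop : ∀ n, v n ≠ ∞ := fun n => measure_ne_top _ _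
  have hv : Tendsto v atTop (𝓝 0) :=
    tendsto_of_tendsto_of_tendsto_of_le_of_le tendsto_const_nhds
      ENNReal.tendsto_inv_nat_nhds_zero (fun _ => zero_le) (hGW.measure_lt_width_le hcrit)
  have hw : Tendsto w atTop (𝓝 1) := by
    have hwv : ∀ n, w n = 1 - v n := fun n =>
      ENNReal.eq_sub_of_add_eq (hvtop n) (hGW.measure_width_le_add n)
    simp only [funext hwv]
    simpa using ENNReal.Tendsto.sub (tendsto_const_nhds (x := (1 : ℝ≥0∞))) hv
      (Or.inl ENNReal.one_ne_top)
  have key := tendsto_of_tsum_le_one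
    (a := fun n (F : Finset Node) =>
      P ({ω | trunc h (τ ω) = F} ∩ {ω | (n : ℕ∞) < width (τ ω)}) / v n)
    (b := fun n (F : Finset Node) => P {ω | trunc h (τ ω) = F} *
      ∑ i ∈ Finset.range (Y h (F : Set Node)), w n ^ i)
    (κ := fun F : Finset Node => P {ω | trunc h (τ ω) = F} * Y h (F : Set Node))
    ?_ ?_ ?_ ?_ (trunc h t)
  · have hset : {ω | trunc h (τ ω) = trunc h t} = {ω | restrict h (τ ω) = t} := by
      ext ω
      change trunc h (τ ω) = trunc h t ↔ restrict h (τ ω) = t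
      rw [(hGW.1 ω).trunc_eq_trunc_iff ht, restrict_eq_self hth]
    have hκ : kesten p h t =
        P {ω | trunc h (τ ω) = trunc h t} * Y h (trunc h t : Set Node) := by
      rw [kesten, hcrit, inv_one, one_pow, one_mul, hGW.measure_trunc_eq h ht,
        Y_trunc ht le_rfl, mul_comm]
    rw [hκ, ← hset]
    exact key
  · intro n F
    by_cases hne : ∃ ω, trunc h (τ ω) = F
    · obtain ⟨ω, rfl⟩ := hne
      have hle := hGW.le_measure_trunc_eq_inter h n (hGW.1 ω)
      rw [ENNReal.le_div_iff_mul_le (Or.inl (hv0 n)) (Or.inl (hvtop n))]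
      refine le_trans (le_of_eq ?_) hle
      rw [hGW.measure_trunc_eq h (hGW.1 ω), Y_trunc (hGW.1 ω) le_rfl]
      ring
    · have : {ω | trunc h (τ ω) = F} = ∅ :=
        Set.eq_empty_of_forall_notMem fun ω hω => hne ⟨ω, hω⟩
      simp [this]
  · intro n
    simp only [div_eq_mul_inv]
    rw [ENNReal.tsum_mul_right, ← div_eq_mul_inv]
    refine ENNReal.div_le_of_le_mul ?_
    rw [one_mul, ← measure_iUnion]
    · exact measure_mono (Set.iUnion_subset fun F => Set.inter_subset_right)
    · intro F G hFG
      rw [Function.onFun, Set.disjoint_left]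
      exact fun ω hF hG => hFG (hF.1.symm.trans hG.1)
    · exact fun F => (hGW.measurableSet_trunc_eq h F).inter (hGW.measurableSet_lt_width n)
  · intro F
    refine ENNReal.Tendsto.const_mul ?_ (Or.inr (measure_ne_top _ _))
    have := tendsto_finsetSum (Finset.range (Y h (F : Set Node))) fun i _ =>
      ((ENNReal.continuous_pow i).tendsto 1).comp hw
    simpa using this
  · have hmean := hGW.lintegral_Y hcrit h
    have hYX : ∀ ω, (Y h (τ ω) : ℝ≥0∞) = (Y h (trunc h (τ ω) : Set Node) : ℝ≥0∞) :=
      fun ω => by rw [Y_trunc (hGW.1 ω) le_rfl]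
    simp only [hYX] at hmean
    rw [← lintegral_map (f := fun F : Finset Node => (Y h (F : Set Node) : ℝ≥0∞))
      Measurable.of_discrete hX, lintegral_countable'] at hmean
    rw [← hmean]
    simp only [hE, mul_comm]
    exact le_rfl

end GWLocal
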